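/- arXiv:math/0612332 — 4 statements merged into one kernel-verified Lean document; each statement's English description precedes it below -/
import Mathlib

section
/- For every integer d ≥ 1, the matrix M_d is totally nonnegative; that is, for every k ≥ 1 and every pair of strictly increasing sequences of row indices 0 ≤ i_1 < ... < i_k ≤ ⌊d/2⌋ and column indices 0 ≤ j_1 < ... < j_k ≤ d−1, the determinant of the k × k submatrix (m_{i_s, j_t})_{1 ≤ s,t ≤ k} of M_d is nonnegative. -/
open Finset PowerSeries

/-- A matrix is totally nonnegative if all of its minors are nonnegative. -/
def Matrix.TotallyNonneg {m n : Type*} [Preorder m] [Preorder n] (A : Matrix m n ℤ) : Prop :=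
  ∀ (k : ℕ) (r : Fin k → m) (c : Fin k → n),
    StrictMono r → StrictMono c → 0 ≤ (A.submatrix r c).det

namespace Matrix

/-- A symmetrized form of the Cauchy–Binet formula. -/
theorem factorial_mul_det_mul {k : ℕ} {l : Type*} [Fintype l]
    (A : Matrix (Fin k) l ℤ) (B : Matrix l (Fin k) ℤ) :
    (k.factorial : ℤ) * (A * B).det =
      ∑ f : Fin k → l, (A.submatrix id f).det * (B.submatrix f id).det := by
  classical
  have expand : (A * B).det = ∑ f : Fin k → l, (A.submatrix id f).det * ∏ i, B (f i) i := by
    simp only [det_apply', mul_apply, prod_univ_sum, mul_sum, Fintype.piFinset_univ, sum_mul]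
    rw [Finset.sum_comm]
    simp [prod_mul_distrib, mul_assoc]
  have permuted (σ : Equiv.Perm (Fin k)) : (A * B).det =
      ∑ f : Fin k → l, (A.submatrix id f).det *
        ((Equiv.Perm.sign σ : ℤ) * ∏ i, B (f (σ i)) i) := by
    rw [expand, ← (Equiv.arrowCongr σ (Equiv.refl l)).symm.sum_comp]
    refine sum_congr rfl fun f _ => ?_
    have := det_permute' σ (A.submatrix id f)
    simp only [submatrix_submatrix, Function.id_comp, Int.cast_id] at this
    change (A.submatrix id (f ∘ σ)).det * ∏ i, B (f (σ i)) i = _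
    rw [show (A.submatrix id (f ∘ σ)).det = _ from this]
    ring
  have total : ∑ _σ : Equiv.Perm (Fin k), (A * B).det = (k.factorial : ℤ) * (A * B).det := by
    simp [Fintype.card_perm]
  rw [← total, sum_congr rfl fun σ _ => permuted σ, sum_comm]
  simp [det_apply', mul_sum]

theorem det_eq_head_mul_of_column {k : ℕ} (A : Matrix (Fin (k + 1)) (Fin (k + 1)) ℤ)
    (h : ∀ i : Fin k, A i.succ 0 = 0) :
    A.det = A 0 0 * (A.submatrix Fin.succ Fin.succ).det := by
  rw [det_succ_column_zero, Fin.sum_univ_succ]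
  simp [h]

theorem det_eq_head_mul_of_row {k : ℕ} (A : Matrix (Fin (k + 1)) (Fin (k + 1)) ℤ)
    (h : ∀ j : Fin k, A 0 j.succ = 0) :
    A.det = A 0 0 * (A.submatrix Fin.succ Fin.succ).det := by
  rw [det_succ_row_zero, Fin.sum_univ_succ]
  simp [h]

namespace TotallyNonneg

section

variable {m n m₁ n₁ : Type*} [LinearOrder m] [LinearOrder n] [LinearOrder m₁] [LinearOrder n₁]

theorem submatrix {A : Matrix m n ℤ} (hA : A.TotallyNonneg) {f : m₁ → m} {g : n₁ → n}
    (hf : StrictMono f) (hg : StrictMono g) : (A.submatrix f g).TotallyNonneg :=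
  fun k r c hr hc => hA k (f ∘ r) (g ∘ c) (hf.comp hr) (hg.comp hc)

theorem submatrix_strictAnti {A : Matrix m n ℤ} (hA : A.TotallyNonneg) {f : m₁ → m} {g : n₁ → n}
    (hf : StrictAnti f) (hg : StrictAnti g) : (A.submatrix f g).TotallyNonneg := by
  intro k r c hr hc
  rw [← det_submatrix_equiv_self Fin.revPerm]
  exact hA k (f ∘ r ∘ Fin.rev) (g ∘ c ∘ Fin.rev)
    (hf.comp (hr.comp_strictAnti Fin.rev_strictAnti))
    (hg.comp (hc.comp_strictAnti Fin.rev_strictAnti))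

theorem transpose {A : Matrix m n ℤ} (hA : A.TotallyNonneg) : Aᵀ.TotallyNonneg := by
  intro k r c hr hc
  rw [← det_transpose]
  exact hA k c r hc hr

theorem mul {l : Type*} [LinearOrder l] [Fintype l] {A : Matrix m l ℤ} {B : Matrix l n ℤ}
    (hA : A.TotallyNonneg) (hB : B.TotallyNonneg) : (A * B).TotallyNonneg := by
  intro k r c hr hc
  have key := factorial_mul_det_mul (A.submatrix r id) (B.submatrix id c)
  rw [← submatrix_mul_equiv A B r (Equiv.refl l) c]
  refine nonneg_of_mul_nonneg_right (a := (k.factorial : ℤ)) ?_ (by positivity)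
  refine key.symm ▸ sum_nonneg fun f _ => ?_
  simp only [submatrix_submatrix, Function.comp_id, Function.id_comp]
  by_cases hf : Function.Injective f
  · have hmono : StrictMono (f ∘ Tuple.sort f) :=
      (Tuple.monotone_sort f).strictMono_of_injective (hf.comp (Tuple.sort f).injective)
    have h₁ := det_permute' (Tuple.sort f) (A.submatrix r f)
    have h₂ := det_permute (Tuple.sort f) (B.submatrix f c)
    simp only [submatrix_submatrix, Function.comp_id, Int.cast_id] at h₁ h₂
    have hsign : ((Equiv.Perm.sign (Tuple.sort f) : ℤˣ) : ℤ) *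
        (Equiv.Perm.sign (Tuple.sort f) : ℤˣ) = 1 := by
      rw [← Units.val_mul, Int.units_mul_self, Units.val_one]
    calc (0 : ℤ) ≤ (A.submatrix r (f ∘ Tuple.sort f)).det *
          (B.submatrix (f ∘ Tuple.sort f) c).det :=
          mul_nonneg (hA k _ _ hr hmono) (hB k _ _ hmono hc)
      _ = (((Equiv.Perm.sign (Tuple.sort f) : ℤˣ) : ℤ) *
          (Equiv.Perm.sign (Tuple.sort f) : ℤˣ)) *
          ((A.submatrix r f).det * (B.submatrix f c).det) := by rw [h₁, h₂]; ring
      _ = _ := by rw [hsign, one_mul]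
  · obtain ⟨i, j, hij, hne⟩ : ∃ i j, f i = f j ∧ i ≠ j := by
      simpa [Function.Injective] using hf
    rw [det_zero_of_row_eq (M := B.submatrix f c) hne (by ext; simp [hij]), mul_zero]

end

/-- Putting the row `(1, 0, 0, …)` on top of a matrix preserves total nonnegativity. -/
theorem of_succ_rows {N : ℕ} {A : Matrix (Fin (N + 1)) ℕ ℤ}
    (h₀ : ∀ j, A 0 j = if j = 0 then 1 else 0)
    (hA : (A.submatrix Fin.succ id).TotallyNonneg) : A.TotallyNonneg := by
  have aux (k : ℕ) (r : Fin k → Fin (N + 1)) (c : Fin k → ℕ) (hr : StrictMono r)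
      (hc : StrictMono c) (hpos : ∀ s, r s ≠ 0) : 0 ≤ (A.submatrix r c).det := by
    have := hA k (fun s => (r s).pred (hpos s)) c
      (fun s t hst => Fin.pred_lt_pred_iff.2 (hr hst)) hc
    simpa [submatrix_submatrix, Function.comp_def] using this
  rintro (_ | k) r c hr hc
  · simp
  · by_cases hzero : r 0 = 0
    · rw [det_eq_head_mul_of_row]
      · refine mul_nonneg ?_ (aux k (r ∘ Fin.succ) (c ∘ Fin.succ)
          (hr.comp Fin.strictMono_succ) (hc.comp Fin.strictMono_succ) fun s => ?_)
        · rw [submatrix_apply, hzero, h₀]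
          split_ifs <;> simp
        · exact (hzero ▸ hr (Fin.succ_pos s) : 0 < r s.succ).ne'
      · intro j
        rw [submatrix_apply, hzero, h₀, if_neg]
        have := hc (Fin.succ_pos j)
        omega
    · exact aux _ r c hr hc fun s => ((Fin.pos_iff_ne_zero.2 hzero).trans_le
        (hr.monotone (Fin.zero_le s))).ne'

end TotallyNonneg

end Matrix

open Matrix

/-- A power series is a Pólya frequency series if its Toeplitz matrix is totally nonnegative. -/
def PowerSeries.IsPolyaFrequency (f : ℤ⟦X⟧) : Prop :=
  TotallyNonneg (of fun i j : ℕ => coeff j (X ^ i * f))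

theorem PowerSeries.coeff_mul_eq_sum_fin {N j : ℕ} (hj : j < N) (h f : ℤ⟦X⟧) :
    coeff j (h * f) = ∑ l : Fin N, coeff (l : ℕ) h * coeff j (X ^ (l : ℕ) * f) := by
  rw [Fin.sum_univ_eq_sum_range (fun l => coeff l h * coeff j (X ^ l * f)), coeff_mul,
    Nat.sum_antidiagonal_eq_sum_range_succ_mk]
  refine sum_subset_zero_on_sdiff (range_subset_range.2 hj) ?_ ?_
  · intro l hl
    simp only [mem_sdiff, mem_range] at hl
    rw [coeff_X_pow_mul', if_neg (by omega), mul_zero]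
  · intro l hl
    rw [coeff_X_pow_mul', if_pos (by simpa [Nat.lt_succ_iff] using hl)]

theorem Matrix.TotallyNonneg.mul_polyaFrequency {m : Type*} [LinearOrder m] {h : m → ℤ⟦X⟧}
    (hh : TotallyNonneg (of fun (a : m) (j : ℕ) => coeff j (h a))) {f : ℤ⟦X⟧}
    (hf : f.IsPolyaFrequency) :
    TotallyNonneg (of fun (a : m) (j : ℕ) => coeff j (h a * f)) := by
  intro k r c hr hc
  obtain ⟨N, hN⟩ : ∃ N, ∀ t, c t < N := by
    refine ⟨univ.sup c + 1, fun t => Nat.lt_succ_of_le (le_sup (f := c) (mem_univ t))⟩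
  have := (hh.submatrix (f := id) (g := fun l : Fin N => (l : ℕ)) strictMono_id
    Fin.val_strictMono).mul
    (hf.submatrix (f := fun l : Fin N => (l : ℕ)) (g := id) Fin.val_strictMono strictMono_id)
    k r c hr hc
  convert this using 2
  ext s t
  exact coeff_mul_eq_sum_fin (hN t) _ _

namespace PowerSeries.IsPolyaFrequency

theorem mul {f g : ℤ⟦X⟧} (hf : f.IsPolyaFrequency) (hg : g.IsPolyaFrequency) :
    (f * g).IsPolyaFrequency := by
  simpa only [IsPolyaFrequency, mul_assoc] using TotallyNonneg.mul_polyaFrequency hf hg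

theorem one_add_C_mul_X {α : ℤ} (hα : 0 ≤ α) : (1 + C α * X : ℤ⟦X⟧).IsPolyaFrequency := by
  have entry (i j : ℕ) : coeff j (X ^ i * (1 + C α * X : ℤ⟦X⟧)) =
      if j = i then 1 else if j = i + 1 then α else 0 := by
    rw [show (X ^ i * (1 + C α * X) : ℤ⟦X⟧) = X ^ i + C α * X ^ (i + 1) by ring,
      map_add, coeff_C_mul, coeff_X_pow, coeff_X_pow]
    split_ifs <;> omega
  intro k
  induction k with
  | zero => simp
  | succ k ih =>
    intro r c hr hc
    have hr₀ (s : Fin k) := hr (Fin.succ_pos s)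
    have hc₀ (s : Fin k) := hc (Fin.succ_pos s)
    have hminor := ih (r ∘ Fin.succ) (c ∘ Fin.succ)
      (hr.comp Fin.strictMono_succ) (hc.comp Fin.strictMono_succ)
    have hhead : 0 ≤ coeff (c 0) (X ^ r 0 * (1 + C α * X : ℤ⟦X⟧)) := by
      rw [entry]
      split_ifs <;> simp [hα]
    rcases le_or_gt (c 0) (r 0) with h | h
    · rw [det_eq_head_mul_of_column]
      · exact mul_nonneg hhead hminor
      · intro s
        have := hr₀ s
        simp only [submatrix_apply, of_apply, entry]
        rw [if_neg (by omega), if_neg (by omega)]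
    · rw [det_eq_head_mul_of_row]
      · exact mul_nonneg hhead hminor
      · intro s
        have := hc₀ s
        simp only [submatrix_apply, of_apply, entry]
        rw [if_neg (by omega), if_neg (by omega)]

theorem one_add_X : (1 + X : ℤ⟦X⟧).IsPolyaFrequency := by
  simpa using one_add_C_mul_X zero_le_one

theorem X_mul {f : ℤ⟦X⟧} (hf : f.IsPolyaFrequency) : (X * f).IsPolyaFrequency := by
  have := hf.submatrix (f := (· + 1)) (g := id) (fun a b h => Nat.succ_lt_succ h) strictMono_id
  simpa only [IsPolyaFrequency, ← mul_assoc, ← pow_succ, submatrix, of_apply, id_eq] using this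

theorem mk_one : (mk 1 : ℤ⟦X⟧).IsPolyaFrequency := by
  have entry (i j : ℕ) : coeff j (X ^ i * (mk 1 : ℤ⟦X⟧)) = if i ≤ j then 1 else 0 := by
    simp [coeff_X_pow_mul']
  intro k
  induction k with
  | zero => simp
  | succ k ih =>
    intro r c hr hc
    have hminor := ih (r ∘ Fin.succ) (c ∘ Fin.succ)
      (hr.comp Fin.strictMono_succ) (hc.comp Fin.strictMono_succ)
    by_cases h : ∃ s : Fin k, r s.succ ≤ c 0
    · obtain ⟨s, hs⟩ := h
      refine (det_zero_of_row_eq (Fin.succ_ne_zero s) ?_).ge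
      ext t
      have h₁ := hc.monotone (Fin.zero_le t)
      have h₂ := hr (Fin.succ_pos s)
      simp only [submatrix_apply, of_apply, entry]
      rw [if_pos (by omega), if_pos (by omega)]
    · rw [det_eq_head_mul_of_column]
      · refine mul_nonneg ?_ hminor
        simp only [submatrix_apply, of_apply, entry]
        split_ifs <;> simp
      · intro s
        simp only [submatrix_apply, of_apply, entry]
        exact if_neg fun hs => h ⟨s, hs⟩

theorem totallyNonneg_pow {f : ℤ⟦X⟧} (hf : f.IsPolyaFrequency) (N : ℕ) :
    TotallyNonneg (of fun (a : Fin N) (j : ℕ) => coeff j (f ^ (a : ℕ))) := by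
  induction N with
  | zero =>
    rintro (_ | k) r
    · simp
    · exact (r 0).elim0
  | succ N ih =>
    refine TotallyNonneg.of_succ_rows (fun j => by simp [coeff_one]) ?_
    have := ih.mul_polyaFrequency hf
    simpa [pow_succ, submatrix, Function.comp_def] using this

/-- The Riordan array of two Pólya frequency series is totally nonnegative. -/
theorem totallyNonneg_riordan {f g : ℤ⟦X⟧} (hg : g.IsPolyaFrequency) (hf : f.IsPolyaFrequency)
    (N : ℕ) : TotallyNonneg (of fun (a : Fin N) (j : ℕ) => coeff j (f ^ (a : ℕ) * g)) :=
  (hf.totallyNonneg_pow N).mul_polyaFrequency hg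

end PowerSeries.IsPolyaFrequency

section Expansion

variable {h Q : ℤ⟦X⟧} {β : ℤ}

theorem coeff_riordan_recurrence (hQ : (1 - X) ^ 2 * Q = 1)
    (hh : (1 - X) ^ 2 * h = 1 + C β * X) (p b : ℕ) :
    coeff (p + 2) ((X * Q) ^ b * h) =
      2 * coeff (p + 1) ((X * Q) ^ b * h) - coeff p ((X * Q) ^ b * h) +
        if b = 0 then 0 else coeff (p + 1) ((X * Q) ^ (b - 1) * h) := by
  cases b with
  | zero =>
    have h₁ : h = X * (C 2 * h) - X * (X * h) + (1 + C β * X) := by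
      rw [← hh, show (C 2 : ℤ⟦X⟧) = 2 from map_ofNat _ _]; ring
    have h₂ := congrArg (coeff (p + 2)) h₁
    simp only [map_add, map_sub, coeff_succ_X_mul, coeff_C_mul, coeff_one, coeff_X] at h₂
    simpa using h₂
  | succ b =>
    have h₁ : (X * Q) ^ (b + 1) * h = X * (C 2 * ((X * Q) ^ (b + 1) * h)) -
        X * (X * ((X * Q) ^ (b + 1) * h)) + X * ((X * Q) ^ b * h) := by
      rw [show (C 2 : ℤ⟦X⟧) = 2 from map_ofNat _ _]
      linear_combination (X * (X * Q) ^ b * h) * hQ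
    have h₂ := congrArg (coeff (p + 2)) h₁
    simp only [map_add, map_sub, coeff_succ_X_mul, coeff_C_mul] at h₂
    simpa using h₂

theorem coeff_X_mul_pow_mul_eq_zero (q h : ℤ⟦X⟧) {p b : ℕ} (hpb : p < b) :
    coeff p ((X * q) ^ b * h) = 0 := by
  rw [mul_pow, mul_assoc, coeff_X_pow_mul', if_neg (by omega)]

/-- A sequence satisfying the recurrence of `(1 + t) ^ (2 * p + 1 + δ) - t ^ (2 * p + 1 + δ)`, with
`z = t * (1 + t)`, expands in powers of `z` with coefficients taken from a Riordan array. -/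
theorem sum_coeff_riordan_mul_pow (hQ : (1 - X) ^ 2 * Q = 1)
    (hh : (1 - X) ^ 2 * h = 1 + C β * X) (D : ℕ → ℤ⟦X⟧)
    (z : ℤ⟦X⟧) (hz : z ≠ 0) (hD₁ : D 1 = (1 + (2 + C β) * z) * D 0)
    (hD : ∀ p, D (p + 2) = (1 + 2 * z) * D (p + 1) - z ^ 2 * D p) (e : ℕ) :
    ∀ p ≤ e, ∑ b ∈ range (e + 1),
      C (coeff p ((X * Q) ^ b * h)) * (z ^ (e - b) * D 0) = z ^ (e - p) * D p := by
  have hh' : h = X * (C 2 * h) - X * (X * h) + (1 + C β * X) := by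
    rw [← hh, show (C 2 : ℤ⟦X⟧) = 2 from map_ofNat _ _]; ring
  have h0 : coeff 0 h = 1 := by
    have := congrArg (coeff 0) hh'
    simpa using this
  have h1 : coeff 1 h = 2 + β := by
    have := congrArg (coeff (0 + 1)) hh'
    simp only [map_add, map_sub, coeff_succ_X_mul, coeff_C_mul, h0] at this
    simpa [coeff_one] using this
  have hQ₀ : coeff 0 Q = 1 := by
    simpa using congrArg (coeff 0) hQ
  intro p
  induction p using Nat.twoStepInduction with
  | zero =>
    intro _
    rw [sum_range_succ', sum_eq_zero]
    · simp [h0]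
    · intro b _
      rw [coeff_X_mul_pow_mul_eq_zero _ _ (by omega)]
      simp
  | one =>
    intro he
    obtain ⟨e, rfl⟩ : ∃ e₀, e = e₀ + 1 := ⟨e - 1, by omega⟩
    rw [sum_range_succ', sum_range_succ', sum_eq_zero]
    · have : coeff (0 + 1) ((X * Q) ^ 1 * h) = 1 := by
        rw [pow_one, mul_assoc, coeff_succ_X_mul]
        rw [coeff_zero_eq_constantCoeff_apply] at h0 hQ₀
        simp [h0, hQ₀]
      simp only [zero_add] at this
      simp only [zero_add, this, pow_zero, one_mul, h1, hD₁]
      simp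
      ring
    · intro b _
      rw [coeff_X_mul_pow_mul_eq_zero _ _ (by omega)]
      simp
  | more p ih₀ ih₁ =>
    intro he
    have ih₀ := ih₀ (by omega)
    have ih₁ := ih₁ (by omega)
    refine mul_left_cancel₀ hz ?_
    have shift : z * ∑ b ∈ range (e + 1), C (if b = 0 then (0 : ℤ) else
        coeff (p + 1) ((X * Q) ^ (b - 1) * h)) * (z ^ (e - b) * D 0) =
        ∑ b ∈ range (e + 1),
          C (coeff (p + 1) ((X * Q) ^ b * h)) * (z ^ (e - b) * D 0) := by
      rw [sum_range_succ', sum_range_succ _ e,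
        coeff_X_mul_pow_mul_eq_zero _ _ (show p + 1 < e by omega)]
      simp only [if_pos, map_zero, zero_mul, add_zero, mul_sum]
      refine sum_congr rfl fun b hb => ?_
      rw [mem_range] at hb
      rw [if_neg (by omega), Nat.add_sub_cancel, show e - b = e - (b + 1) + 1 by omega]
      ring
    have expanded : ∑ b ∈ range (e + 1),
        C (coeff (p + 2) ((X * Q) ^ b * h)) * (z ^ (e - b) * D 0) =
        2 * (z ^ (e - (p + 1)) * D (p + 1)) - z ^ (e - p) * D p +
        ∑ b ∈ range (e + 1), C (if b = 0 then (0 : ℤ) else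
          coeff (p + 1) ((X * Q) ^ (b - 1) * h)) * (z ^ (e - b) * D 0) := by
      rw [← ih₀, ← ih₁, mul_sum, ← sum_sub_distrib, ← sum_add_distrib]
      refine sum_congr rfl fun b _ => ?_
      rw [coeff_riordan_recurrence hQ hh, map_add, map_sub, map_mul, map_ofNat]
      ring
    rw [expanded, mul_add, shift, ih₁, hD, show e - (p + 1) = e - (p + 2) + 1 by omega,
      show e - p = e - (p + 2) + 2 by omega]
    ring

end Expansion

theorem coeff_X_pow_mul_one_add_X_pow (a b j : ℕ) :
    coeff j (X ^ a * (1 + X) ^ b : ℤ⟦X⟧) = if a ≤ j then (b.choose (j - a) : ℤ) else 0 := by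
  have h : ((1 + X) ^ b : ℤ⟦X⟧) = (((1 + Polynomial.X) ^ b : Polynomial ℤ) : ℤ⟦X⟧) := by simp
  rw [coeff_X_pow_mul', h, Polynomial.coeff_coe, Polynomial.coeff_one_add_X_pow]

theorem coeff_gTheorem_row {d i j : ℕ} (hi : i ≤ d / 2) (hj : j < d) :
    coeff (j + 1) (X ^ i * (1 + X) ^ (d + 1 - i) - X ^ (d + 1 - i) * (1 + X) ^ i : ℤ⟦X⟧) =
      ((d + 1 - i).choose (d - j) : ℤ) - (i.choose (d - j) : ℤ) := by
  rw [map_sub, coeff_X_pow_mul_one_add_X_pow, coeff_X_pow_mul_one_add_X_pow]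
  congr 1
  · split_ifs with h
    · rw [← Nat.choose_symm_of_eq_add (show d + 1 - i = (d - j) + (j + 1 - i) by omega)]
    · rw [Nat.choose_eq_zero_of_lt (by omega), Nat.cast_zero]
  · split_ifs with h
    · rw [← Nat.choose_symm_of_eq_add (show i = (d - j) + (j + 1 - (d + 1 - i)) by omega)]
    · rw [Nat.choose_eq_zero_of_lt (by omega), Nat.cast_zero]

/-- The `g`-theorem matrix factors through two Riordan arrays. -/
theorem gTheorem_matrix_eq_sum {d δ : ℕ} (hδ : δ < 2) {e : ℕ} (hd : d = 2 * e + δ)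
    {i j : ℕ} (hi : i ≤ e) (hj : j < d) :
    ((d + 1 - i).choose (d - j) : ℤ) - (i.choose (d - j) : ℤ) =
      ∑ b ∈ range (e + 1),
        coeff (e - i) ((X * (PowerSeries.mk 1 * PowerSeries.mk 1)) ^ b *
          (PowerSeries.mk 1 * PowerSeries.mk 1 * (1 + C (1 - δ : ℤ) * X))) *
        coeff (j + 1) ((X * (1 + X)) ^ (e - b) * (1 + C (2 * δ : ℤ) * X) : ℤ⟦X⟧) := by
  have hK : (PowerSeries.mk 1 : ℤ⟦X⟧) * (1 - X) = 1 := mk_one_mul_one_sub_eq_one ℤ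
  have hQ : (1 - X) ^ 2 * (PowerSeries.mk 1 * PowerSeries.mk 1 : ℤ⟦X⟧) = 1 := by
    linear_combination (PowerSeries.mk 1 * (1 - X) + 1) * hK
  have hh : (1 - X) ^ 2 * (PowerSeries.mk 1 * PowerSeries.mk 1 * (1 + C (1 - δ : ℤ) * X)) =
      (1 + C (1 - δ : ℤ) * X : ℤ⟦X⟧) := by
    rw [← mul_assoc, hQ, one_mul]
  have hz : (X * (1 + X) : ℤ⟦X⟧) ≠ 0 := by
    refine mul_ne_zero X_ne_zero fun h => ?_
    simpa using congrArg (coeff 0) h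
  have hD₀ : ((1 + X) ^ (2 * 0 + 1 + δ) - X ^ (2 * 0 + 1 + δ) : ℤ⟦X⟧) = 1 + C (2 * δ : ℤ) * X := by
    interval_cases δ <;> simp [show (C 2 : ℤ⟦X⟧) = 2 from map_ofNat _ _]; ring
  have hD₁ : ((1 + X) ^ (2 * 1 + 1 + δ) - X ^ (2 * 1 + 1 + δ) : ℤ⟦X⟧) =
      (1 + (2 + C (1 - δ : ℤ)) * (X * (1 + X))) *
        ((1 + X) ^ (2 * 0 + 1 + δ) - X ^ (2 * 0 + 1 + δ)) := by
    interval_cases δ <;> simp <;> ring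
  have key := sum_coeff_riordan_mul_pow hQ hh
    (fun p => ((1 + X) ^ (2 * p + 1 + δ) - X ^ (2 * p + 1 + δ) : ℤ⟦X⟧)) (X * (1 + X)) hz
    hD₁ (fun p => by ring) e (e - i) (by omega)
  rw [← coeff_gTheorem_row (by omega) hj]
  have hrow : (X ^ i * (1 + X) ^ (d + 1 - i) - X ^ (d + 1 - i) * (1 + X) ^ i : ℤ⟦X⟧) =
      (X * (1 + X)) ^ (e - (e - i)) *
        ((1 + X) ^ (2 * (e - i) + 1 + δ) - X ^ (2 * (e - i) + 1 + δ)) := by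
    rw [show d + 1 - i = i + (2 * (e - i) + 1 + δ) by omega, show e - (e - i) = i by omega, mul_pow]
    ring
  rw [hrow, ← key, hD₀, map_sum]
  exact sum_congr rfl fun b _ => coeff_C_mul _ _ _

/-- Björner's totally nonnegative conjecture: for every `d ≥ 1`, the matrix `M_d`
with entries `m_{ij} = C(d+1-i, d-j) - C(i, d-j)` (rows `0 ≤ i ≤ ⌊d/2⌋`, columns
`0 ≤ j ≤ d-1`) is totally nonnegative: every minor along strictly increasing row
and column indices has nonnegative determinant. -/
theorem M_d_totally_nonnegative (d : ℕ) (hd : 1 ≤ d)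
    (M : Matrix (Fin (d / 2 + 1)) (Fin d) ℤ)
    (hM : ∀ i j, M i j =
      ((d + 1 - (i : ℕ)).choose (d - (j : ℕ)) : ℤ) - ((i : ℕ).choose (d - (j : ℕ)) : ℤ)) :
    ∀ (k : ℕ), 1 ≤ k → ∀ (r : Fin k → Fin (d / 2 + 1)) (c : Fin k → Fin d),
      StrictMono r → StrictMono c → 0 ≤ (M.submatrix r c).det := by
  intro k _
  suffices hM' : M.TotallyNonneg from hM' k
  have hδ : d % 2 < 2 := Nat.mod_lt _ two_pos
  have hδ' : (0 : ℤ) ≤ 1 - (d % 2 : ℕ) := by omega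
  have hK := IsPolyaFrequency.mk_one.mul IsPolyaFrequency.mk_one
  have hA := ((hK.mul (.one_add_C_mul_X hδ')).totallyNonneg_riordan hK.X_mul
    (d / 2 + 1)).transpose.submatrix_strictAnti (f := fun i : Fin (d / 2 + 1) => d / 2 - (i : ℕ))
      (g := Fin.rev) (fun i j hij => by
        have := j.2
        simp only [Fin.lt_def] at hij ⊢
        omega)
      Fin.rev_strictAnti
  have hB := ((IsPolyaFrequency.one_add_C_mul_X
    (show (0 : ℤ) ≤ 2 * (d % 2 : ℕ) by positivity)).totallyNonneg_riordan
      IsPolyaFrequency.one_add_X.X_mul (d / 2 + 1)).submatrix (f := id)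
        (g := fun j : Fin d => (j : ℕ) + 1) strictMono_id (fun i j hij => Nat.succ_lt_succ hij)
  convert hA.mul hB using 1
  ext i j
  rw [hM, gTheorem_matrix_eq_sum hδ (Nat.div_add_mod d 2).symm (Nat.lt_succ_iff.1 i.2) j.2,
    mul_apply, ← Equiv.sum_comp Fin.revPerm, ← Fin.sum_univ_eq_sum_range]
  refine sum_congr rfl fun b _ => ?_
  simp [Fin.val_rev]
end

section
/- For every integer n ≥ 2, the matrix W_n is totally nonnegative; that is, for every k ≥ 1 and every pair of strictly increasing sequences of row indices 0 ≤ i_1 < ... < i_k ≤ ⌈n/2⌉−1 and column indices 0 ≤ j_1 < ... < j_k ≤ n−1, the determinant of the k × k submatrix (W(n, i_s, j_t))_{1 ≤ s,t ≤ k} of W_n is nonnegative. -/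
open Finset Polynomial

/-- Expansion of `det (A * B)` over all choices of an intermediate index in each row. -/
theorem det_mul_eq_sum_fun {ι κ R : Type*} [Fintype ι] [DecidableEq ι] [Fintype κ]
    [CommRing R] (A : Matrix ι κ R) (B : Matrix κ ι R) :
    (A * B).det = ∑ f : ι → κ, (∏ i, A i (f i)) * (B.submatrix f id).det := by
  have hrow : A * B = fun i => ∑ l, A i l • B l := by
    ext i j
    simp [Matrix.mul_apply]
  rw [hrow]
  refine ((Matrix.detRowAlternating (R := R) (n := ι)).toMultilinearMap.map_sum _).trans ?_
  refine Finset.sum_congr rfl fun f _ => ?_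
  exact (Matrix.detRowAlternating (R := R) (n := ι)).toMultilinearMap.map_smul_univ
    (fun i => A i (f i)) (fun i => B (f i))

/-- A form of the Cauchy–Binet formula summing over all maps, each index set being counted
`k!` times. -/
theorem factorial_mul_det_mul {ι κ R : Type*} [Fintype ι] [DecidableEq ι] [Fintype κ]
    [CommRing R] (A : Matrix ι κ R) (B : Matrix κ ι R) :
    ((Fintype.card ι).factorial : R) * (A * B).det =
      ∑ f : ι → κ, (A.submatrix id f).det * (B.submatrix f id).det := by
  have hperm (σ : Equiv.Perm ι) : (A * B).det =
      ∑ f : ι → κ, (Equiv.Perm.sign σ * ∏ i, A i (f (σ i))) * (B.submatrix f id).det := by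
    rw [det_mul_eq_sum_fun, ← Equiv.sum_comp (Equiv.arrowCongr σ.symm (Equiv.refl κ))]
    refine Finset.sum_congr rfl fun f _ => ?_
    have hB := Matrix.det_permute σ (B.submatrix f id)
    rw [Matrix.submatrix_submatrix] at hB
    change (∏ i, A i (f (σ i))) * (B.submatrix (f ∘ σ) (id ∘ id)).det = _
    rw [hB]
    ring
  have hdet (f : ι → κ) : (A.submatrix id f).det =
      ∑ σ : Equiv.Perm ι, (Equiv.Perm.sign σ * ∏ i, A i (f (σ i)) : R) := by
    rw [← Matrix.det_transpose, Matrix.det_apply']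
    simp
  simp_rw [hdet, Finset.sum_mul]
  rw [Finset.sum_comm, ← Finset.sum_congr rfl fun σ _ => hperm σ]
  simp [Fintype.card_perm]

theorem det_of_first_row {k : ℕ} {R : Type*} [CommRing R]
    (A : Matrix (Fin (k + 1)) (Fin (k + 1)) R) (h : ∀ t : Fin k, A 0 t.succ = 0) :
    A.det = A 0 0 * (A.submatrix Fin.succ Fin.succ).det := by
  rw [Matrix.det_succ_row_zero, Fin.sum_univ_succ, Finset.sum_eq_zero fun t _ => by simp [h]]
  simp

theorem det_of_first_column {k : ℕ} {R : Type*} [CommRing R]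
    (A : Matrix (Fin (k + 1)) (Fin (k + 1)) R) (h : ∀ s : Fin k, A s.succ 0 = 0) :
    A.det = A 0 0 * (A.submatrix Fin.succ Fin.succ).det := by
  rw [Matrix.det_succ_column_zero, Fin.sum_univ_succ, Finset.sum_eq_zero fun t _ => by simp [h]]
  simp

/-- The minors of `A : ℕ → ℕ → ℤ` using only the first `N` rows are nonnegative. -/
def NonnegMinors (N : ℕ) (A : ℕ → ℕ → ℤ) : Prop :=
  ∀ (k : ℕ) (r c : Fin k → ℕ), StrictMono r → StrictMono c → (∀ s, r s < N) →
    0 ≤ (Matrix.of fun s t => A (r s) (c t)).det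

namespace NonnegMinors

variable {N M : ℕ} {A B : ℕ → ℕ → ℤ}

theorem congr (hA : NonnegMinors N A) (h : ∀ i < N, ∀ j, B i j = A i j) : NonnegMinors N B := by
  intro k r c hr hc hN
  have := hA k r c hr hc hN
  simpa only [h _ (hN _)] using this

theorem mul (hA : NonnegMinors N A) (hB : NonnegMinors M B) :
    NonnegMinors N fun i j => ∑ l ∈ range M, A i l * B l j := by
  intro k r c hr hc hN
  set P : Matrix (Fin k) (Fin M) ℤ := Matrix.of fun s l => A (r s) l
  set Q : Matrix (Fin M) (Fin k) ℤ := Matrix.of fun l t => B l (c t)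
  have hPQ : (Matrix.of fun s t => ∑ l ∈ range M, A (r s) l * B l (c t)) = P * Q := by
    ext s t
    simp [P, Q, Matrix.mul_apply, Finset.sum_range]
  rw [hPQ]
  have hpos : (0 : ℤ) < ((Fintype.card (Fin k)).factorial : ℤ) := by
    exact_mod_cast Nat.factorial_pos _
  refine nonneg_of_mul_nonneg_right ?_ hpos
  rw [factorial_mul_det_mul]
  refine Finset.sum_nonneg fun f _ => ?_
  by_cases hf : Function.Injective f
  · set τ := Tuple.sort f
    have hmono : StrictMono (f ∘ τ) :=
      (Tuple.monotone_sort f).strictMono_of_injective (hf.comp τ.injective)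
    have hP := Matrix.det_permute' τ (P.submatrix id f)
    have hQ := Matrix.det_permute τ (Q.submatrix f id)
    have hP0 : 0 ≤ ((P.submatrix id f).submatrix id τ).det :=
      hA k r (fun s => (f (τ s) : ℕ)) hr (fun _ _ h => hmono h) hN
    have hQ0 : 0 ≤ ((Q.submatrix f id).submatrix τ id).det :=
      hB k (fun s => (f (τ s) : ℕ)) c (fun _ _ h => hmono h) hc fun s => (f (τ s)).2
    have hmul := mul_nonneg hP0 hQ0
    rw [hP, hQ] at hmul
    rcases Int.units_eq_one_or (Equiv.Perm.sign τ) with h | h <;> simpa [h] using hmul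
  · simp only [Function.Injective, not_forall] at hf
    obtain ⟨a, b, hab, hne⟩ := hf
    rw [Matrix.det_zero_of_row_eq (M := Q.submatrix f id) hne (by ext t; simp [hab]), mul_zero]

/-- Right multiplication by an upper triangular matrix with nonnegative minors. -/
theorem mul_of_upper (hA : NonnegMinors N A) {T : ℕ → ℕ → ℤ} (hT : ∀ M, NonnegMinors M T)
    (hB : ∀ i j M, j < M → B i j = ∑ l ∈ range M, A i l * T l j) : NonnegMinors N B := by
  intro k r c hr hc hN
  set M := (univ.sup c) + 1
  have hM (t) : c t < M := Nat.lt_succ_of_le (Finset.le_sup (Finset.mem_univ t))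
  have := hA.mul (hT M) k r c hr hc hN
  simpa only [hB _ _ M (hM _)] using this

/-- If at every position the row vanishes to the right or the column vanishes below, then the
minors are products of entries or zero. -/
theorem of_row_or_column (h0 : ∀ i j, 0 ≤ A i j)
    (h : ∀ i j, (∀ j' > j, A i j' = 0) ∨ ∀ i' > i, A i' j = 0) : NonnegMinors N A := by
  intro k
  induction k with
  | zero => intro r c _ _ _; simp
  | succ k ih =>
    intro r c hr hc hN
    have hminor := ih (r ∘ Fin.succ) (c ∘ Fin.succ) (hr.comp Fin.strictMono_succ)
      (hc.comp Fin.strictMono_succ) fun s => hN _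
    have hexp : (Matrix.of fun s t => A (r s) (c t)).det = A (r 0) (c 0) *
        (Matrix.of fun s t => A ((r ∘ Fin.succ) s) ((c ∘ Fin.succ) t)).det := by
      rcases h (r 0) (c 0) with h | h
      · exact det_of_first_row _ fun t => h _ (hc (Fin.succ_pos t))
      · exact det_of_first_column _ fun s => h _ (hr (Fin.succ_pos s))
    rw [hexp]
    exact mul_nonneg (h0 _ _) hminor

end NonnegMinors

/-- The direct sum of the `1 × 1` identity matrix and `A`. -/
def oneDirectSum (A : ℕ → ℕ → ℤ) : ℕ → ℕ → ℤ
  | 0, 0 => 1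
  | 0, _ + 1 => 0
  | _ + 1, 0 => 0
  | i + 1, j + 1 => A i j

namespace NonnegMinors

variable {N : ℕ} {A : ℕ → ℕ → ℤ}

theorem oneDirectSum_of_pos (hA : NonnegMinors N A) {k : ℕ} {r c : Fin k → ℕ} (hr : StrictMono r)
    (hc : StrictMono c) (hN : ∀ s, r s < N + 1) (hr0 : ∀ s, 0 < r s) (hc0 : ∀ s, 0 < c s) :
    0 ≤ (Matrix.of fun s t => oneDirectSum A (r s) (c t)).det := by
  have hentry (s t) : oneDirectSum A (r s) (c t) = A (r s - 1) (c t - 1) := by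
    obtain ⟨a, ha⟩ := Nat.exists_eq_succ_of_ne_zero (hr0 s).ne'
    obtain ⟨b, hb⟩ := Nat.exists_eq_succ_of_ne_zero (hc0 t).ne'
    simp [ha, hb, oneDirectSum]
  simp only [hentry]
  refine hA k (fun s => r s - 1) (fun t => c t - 1) (fun a b h => ?_) (fun a b h => ?_) fun s => ?_
  · have := hr h; have := hr0 a; dsimp only; omega
  · have := hc h; have := hc0 a; dsimp only; omega
  · have := hN s; have := hr0 s; omega

theorem oneDirectSum (hA : NonnegMinors N A) : NonnegMinors (N + 1) (oneDirectSum A) := by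
  intro k r c hr hc hN
  rcases k with _ | k
  · simp
  have hrpos (s : Fin k) : 0 < r s.succ := (Nat.zero_le _).trans_lt (hr (Fin.succ_pos s))
  have hcpos (s : Fin k) : 0 < c s.succ := (Nat.zero_le _).trans_lt (hc (Fin.succ_pos s))
  have hrow (t) (ht : 0 < t) : _root_.oneDirectSum A 0 t = 0 := by
    obtain ⟨b, rfl⟩ := Nat.exists_eq_succ_of_ne_zero ht.ne'; rfl
  have hcol (t) (ht : 0 < t) : _root_.oneDirectSum A t 0 = 0 := by
    obtain ⟨b, rfl⟩ := Nat.exists_eq_succ_of_ne_zero ht.ne'; rfl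
  have hall {r : Fin (k + 1) → ℕ} (hr : StrictMono r) (h : 0 < r 0) (s) : 0 < r s :=
    h.trans_le (hr.monotone (Fin.zero_le s))
  rcases Nat.eq_zero_or_pos (r 0) with hr0 | hr0 <;> rcases Nat.eq_zero_or_pos (c 0) with hc0 | hc0
  · rw [det_of_first_row _ fun t => by simp [hr0, hrow _ (hcpos t)]]
    refine mul_nonneg (by simp [hr0, hc0, _root_.oneDirectSum]) ?_
    exact hA.oneDirectSum_of_pos (hr.comp Fin.strictMono_succ) (hc.comp Fin.strictMono_succ)
      (fun s => hN _) hrpos hcpos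
  · rw [Matrix.det_eq_zero_of_row_eq_zero 0]
    intro t
    simp [hr0, hrow _ (hall hc hc0 t)]
  · rw [Matrix.det_eq_zero_of_column_eq_zero 0]
    intro t
    simp [hc0, hcol _ (hall hr hr0 t)]
  · exact hA.oneDirectSum_of_pos hr hc hN (hall hr hr0) (hall hc hc0)

/-- The lower triangular all-ones matrix has nonnegative minors. -/
theorem lowerOnes : NonnegMinors N fun i j => if j ≤ i then 1 else 0 := by
  intro k
  induction k with
  | zero => intro r c _ _ _; simp
  | succ k ih =>
    intro r c hr hc hN
    by_cases h0 : c 0 ≤ r 0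
    · by_cases h1 : ∃ t : Fin k, c t.succ ≤ r 0
      · obtain ⟨t, ht⟩ := h1
        rw [Matrix.det_zero_of_column_eq (Fin.succ_ne_zero t)]
        intro s
        have := hr.monotone (Fin.zero_le s)
        simp [ht.trans this, h0.trans this]
      · push Not at h1
        rw [det_of_first_row _ fun t => by simp [h1 t]]
        refine mul_nonneg (by simp [h0]) ?_
        exact ih (r ∘ Fin.succ) (c ∘ Fin.succ) (hr.comp Fin.strictMono_succ)
          (hc.comp Fin.strictMono_succ) fun s => hN _
    · rw [Matrix.det_eq_zero_of_row_eq_zero 0]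
      intro t
      have := hc.monotone (Fin.zero_le t)
      simp only [Matrix.of_apply, ite_eq_right_iff]
      omega

theorem prefixSum (hA : NonnegMinors N A) :
    NonnegMinors N fun i j => ∑ l ∈ range (i + 1), A l j := by
  refine (lowerOnes (N := N) |>.mul hA).congr fun i hi j => ?_
  simp only [ite_mul, one_mul, zero_mul, ← Finset.sum_filter]
  refine Finset.sum_congr ?_ fun _ _ => rfl
  ext l
  simp only [mem_range, mem_filter]
  omega

/-- Partial sums of the rows of index at least one. -/
theorem prefixSum_tail (hA : NonnegMinors (N + 1) A) :
    NonnegMinors (N + 1) fun i j => if i = 0 then A 0 j else ∑ l ∈ range i, A (l + 1) j := by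
  refine (lowerOnes (N := N) |>.oneDirectSum.mul hA).congr fun i hi j => ?_
  rw [Finset.sum_range_succ']
  rcases i with _ | i
  · simp [_root_.oneDirectSum]
  · simp only [_root_.oneDirectSum, ite_mul, one_mul, zero_mul, ← Finset.sum_filter]
    simp only [Nat.add_eq_zero_iff, one_ne_zero, and_false, if_false, add_zero]
    refine Finset.sum_congr ?_ fun _ _ => rfl
    ext l
    simp only [mem_range, mem_filter]
    omega

/-- Adding `w` times row zero to row one. -/
theorem add_first_row (hA : NonnegMinors N A) {w : ℤ} (hw : 0 ≤ w) :
    NonnegMinors N fun i j => A i j + if i = 1 then w * A 0 j else 0 := by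
  have hT : NonnegMinors N fun i j => if j = i then 1 else if i = 1 ∧ j = 0 then w else 0 := by
    refine of_row_or_column (fun i j => by split_ifs <;> simp [hw]) fun i j => ?_
    rcases le_or_gt i j with h | h
    · left
      intro j' hj'
      rw [if_neg (by omega), if_neg (by omega)]
    · right
      intro i' hi'
      rw [if_neg (by omega), if_neg (by omega)]
  refine (hT.mul hA).congr fun i hi j => ?_
  have hsplit (l : ℕ) : (if l = i then 1 else if i = 1 ∧ l = 0 then w else 0) * A l j =
      (if l = i then A i j else 0) + if l = 0 then (if i = 1 then w * A 0 j else 0) else 0 := by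
    split_ifs <;> first | omega | simp_all
  simp only [hsplit, Finset.sum_add_distrib, Finset.sum_ite_eq', mem_range, if_pos hi,
    if_pos (Nat.zero_lt_of_lt hi)]

/-- Adding to selected columns the preceding column, possibly after rescaling. -/
theorem add_prev_column (hA : NonnegMinors N A) {a b : ℕ → ℤ} (ha : ∀ j, 0 ≤ a j)
    (hb : ∀ j, 0 ≤ b j) :
    NonnegMinors N fun i j => a j * A i j + if j = 0 then 0 else b j * A i (j - 1) := by
  refine hA.mul_of_upper (T := fun i j => if i = j then a j else if j = i + 1 then b j else 0)
    (fun M => of_row_or_column (fun i j => ?_) fun i j => ?_) fun i j M hM => ?_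
  · split_ifs <;> simp [ha, hb]
  · rcases lt_or_ge i j with h | h
    · left
      intro j' hj'
      rw [if_neg (by omega), if_neg (by omega)]
    · right
      intro i' hi'
      rw [if_neg (by omega), if_neg (by omega)]
  · have hsplit (l : ℕ) : A i l * (if l = j then a j else if j = l + 1 then b j else 0) =
      (if l = j then a j * A i j else 0) +
        if l = j - 1 then (if j = 0 then 0 else b j * A i (j - 1)) else 0 := by
      split_ifs <;> first | omega | (subst_vars; simp [mul_comm])
    simp only [hsplit, Finset.sum_add_distrib, Finset.sum_ite_eq', mem_range, if_pos hM,
      if_pos ((Nat.sub_le j 1).trans_lt hM)]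

end NonnegMinors

/-- The sequence `0, f 0, f 1, …`. -/
def shiftSeq (f : ℕ → ℤ) : ℕ → ℤ
  | 0 => 0
  | j + 1 => f j

/-- Coefficient sequences of the polynomials `S k` and `L k` in a variable `z` determined by
`S 0 = 1`, `L 0 = w`, `L (k + 1) = L k + z * S k` and `S (k + 1) = S k + L (k + 1)`.
For `z = y + y⁻¹ - 2` and `w = 2` these are `S k = ∑ s ∈ [-k, k], y ^ s` and
`L k = y ^ k + y ^ (-k)`. -/
def chebyshevCoeffs (w : ℤ) : ℕ → (ℕ → ℤ) × (ℕ → ℤ)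
  | 0 => (fun j => if j = 0 then 1 else 0, fun j => if j = 0 then w else 0)
  | k + 1 =>
    (fun j => (chebyshevCoeffs w k).1 j +
      ((chebyshevCoeffs w k).2 j + shiftSeq (chebyshevCoeffs w k).1 j),
    fun j => (chebyshevCoeffs w k).2 j + shiftSeq (chebyshevCoeffs w k).1 j)

theorem oneDirectSum_succ (A : ℕ → ℕ → ℤ) (i j : ℕ) :
    oneDirectSum A (i + 1) j = shiftSeq (A i) j := by
  cases j <;> rfl

theorem oneDirectSum_zero (A : ℕ → ℕ → ℤ) (j : ℕ) :
    oneDirectSum A 0 j = if j = 0 then 1 else 0 := by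
  cases j <;> rfl

theorem nonnegMinors_chebyshevCoeffs {w : ℤ} (hw : 0 ≤ w) (N : ℕ) :
    NonnegMinors N fun k j => (chebyshevCoeffs w k).1 j := by
  induction N with
  | zero =>
    intro k r c _ _ hN
    rcases k with _ | k
    · simp
    · exact absurd (hN 0) (Nat.not_lt_zero _)
  | succ N ih =>
    refine (ih.oneDirectSum.add_first_row hw).prefixSum_tail.prefixSum.congr fun k _ j => ?_
    have hL (k : ℕ) : (chebyshevCoeffs w (k + 1)).2 j = ∑ l ∈ range (k + 1),
        (oneDirectSum (fun k j => (chebyshevCoeffs w k).1 j) (l + 1) j +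
          if l + 1 = 1 then w * oneDirectSum (fun k j => (chebyshevCoeffs w k).1 j) 0 j else 0) := by
      induction k with
      | zero => simp [oneDirectSum_succ, oneDirectSum_zero, chebyshevCoeffs, add_comm]
      | succ k ihk =>
        rw [Finset.sum_range_succ, ← ihk, chebyshevCoeffs]
        simp [oneDirectSum_succ]
    induction k with
    | zero => simp [oneDirectSum_zero, chebyshevCoeffs]
    | succ k ihk =>
      rw [Finset.sum_range_succ, ← ihk (by omega), if_neg (Nat.succ_ne_zero k), ← hL]
      rfl

/-- The value at `z = X ^ 2 / (1 + X)` of the polynomial in `z` with coefficients `f 0, …, f h`,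
multiplied by `(1 + X) ^ h`. -/
noncomputable def evalHom (f : ℕ → ℤ) (h : ℕ) : ℤ[X] :=
  ∑ j ∈ range (h + 1), C (f j) * (X ^ (2 * j) * (1 + X) ^ (h - j))

theorem evalHom_add (f g : ℕ → ℤ) (h : ℕ) :
    evalHom (fun j => f j + g j) h = evalHom f h + evalHom g h := by
  simp only [evalHom, C_add, add_mul, Finset.sum_add_distrib]

theorem evalHom_shiftSeq (f : ℕ → ℤ) (h : ℕ) :
    evalHom (shiftSeq f) (h + 1) = X ^ 2 * evalHom f h := by
  rw [evalHom, Finset.sum_range_succ', evalHom, Finset.mul_sum]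
  simp only [shiftSeq, C_0, zero_mul, add_zero]
  refine Finset.sum_congr rfl fun j _ => ?_
  rw [Nat.add_sub_add_right]
  ring

theorem evalHom_ite (a : ℤ) (h : ℕ) :
    evalHom (fun j => if j = 0 then a else 0) h = C a * (1 + X) ^ h := by
  rw [evalHom, Finset.sum_range_succ', Finset.sum_eq_zero fun j _ => by simp]
  simp

theorem mul_evalHom_chebyshevCoeffs {w : ℤ} {e : ℕ} {V : ℤ[X]}
    (hS : X * V = (1 + X) ^ (1 + e) - 1) (hL : C w * V = (1 + X) ^ e + 1) (k : ℕ) :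
    ∀ h, k ≤ h →
      X * V * evalHom (chebyshevCoeffs w k).1 h = (1 + X) ^ (h + 1 + k + e) - (1 + X) ^ (h - k) ∧
      V * evalHom (chebyshevCoeffs w k).2 h = (1 + X) ^ (h + k + e) + (1 + X) ^ (h - k) := by
  induction k with
  | zero =>
    intro h _
    simp only [chebyshevCoeffs, evalHom_ite, map_one, one_mul, Nat.sub_zero, Nat.add_zero]
    constructor
    · rw [hS]; ring
    · rw [mul_left_comm, ← mul_assoc, hL]; ring
  | succ k ih =>
    intro h hk
    obtain ⟨h, rfl⟩ : ∃ h', h = h' + 1 := ⟨h - 1, by omega⟩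
    obtain ⟨d, rfl⟩ : ∃ d, h = k + d := ⟨h - k, by omega⟩
    obtain ⟨hS', hL'⟩ := ih (k + d + 1) (by omega)
    have hS'' := (ih (k + d) (by omega)).1
    rw [show k + d + 1 - k = d + 1 by omega] at hS' hL'
    rw [show k + d - k = d by omega] at hS''
    have hstep : V * evalHom (chebyshevCoeffs w (k + 1)).2 (k + d + 1) =
        (1 + X) ^ (k + d + 1 + (k + 1) + e) + (1 + X) ^ d := by
      rw [chebyshevCoeffs, evalHom_add, evalHom_shiftSeq]
      linear_combination hL' + X * hS''
    rw [show k + d + 1 - (k + 1) = d by omega]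
    refine ⟨?_, hstep⟩
    have hsum : evalHom (chebyshevCoeffs w (k + 1)).1 (k + d + 1) =
        evalHom (chebyshevCoeffs w k).1 (k + d + 1) +
          evalHom (chebyshevCoeffs w (k + 1)).2 (k + d + 1) :=
      evalHom_add _ _ _
    rw [hsum]
    linear_combination hS' + X * hstep

theorem nonnegMinors_coeff_X_pow_mul (N h : ℕ) :
    NonnegMinors N fun j m => (X ^ (2 * j) * (1 + X) ^ (h - j) : ℤ[X]).coeff m := by
  induction h with
  | zero =>
    simp only [Nat.zero_sub, pow_zero, mul_one, coeff_X_pow]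
    refine NonnegMinors.of_row_or_column (fun i j => by split_ifs <;> simp) fun i j => ?_
    rcases le_or_gt (2 * i) j with h | h
    · exact Or.inl fun j' hj' => if_neg (by omega)
    · exact Or.inr fun i' hi' => if_neg (by omega)
  | succ h ih =>
    refine (ih.add_prev_column (a := fun _ => 1) (b := fun m => if m ≤ 2 * h + 1 then 1 else 0)
      (fun _ => zero_le_one) fun m => by split_ifs <;> simp).congr fun j _ m => ?_
    rcases le_or_gt j h with hj | hj
    · rw [Nat.succ_sub hj, pow_succ, ← mul_assoc, mul_add, mul_one, coeff_add]
      rcases m with _ | m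
      · simp
      · rw [coeff_mul_X]
        simp only [one_mul, Nat.add_eq_zero_iff, one_ne_zero, and_false, if_false,
          Nat.add_sub_cancel]
        split_ifs with hm
        · rw [one_mul]
        · have hzero : (X ^ (2 * j) * (1 + X) ^ (h - j) : ℤ[X]).coeff m = 0 := by
            rw [coeff_X_pow_mul', coeff_one_add_X_pow, Nat.choose_eq_zero_of_lt (by omega),
              Nat.cast_zero, ite_self]
          rw [hzero, zero_mul]
    · rw [Nat.sub_eq_zero_of_le hj, Nat.sub_eq_zero_of_le hj.le]
      simp only [pow_zero, mul_one, coeff_X_pow, one_mul]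
      split_ifs <;> omega

theorem nonnegMinors_coeff_mul_evalHom {w a b : ℤ} (hw : 0 ≤ w) (ha : 0 ≤ a) (hb : 0 ≤ b)
    (N h : ℕ) : NonnegMinors N fun k m =>
      ((C a + C b * X) * evalHom (chebyshevCoeffs w k).1 h).coeff m := by
  have hcol := (nonnegMinors_coeff_X_pow_mul (h + 1) h).add_prev_column (a := fun _ => a)
    (b := fun _ => b) (fun _ => ha) fun _ => hb
  refine ((nonnegMinors_chebyshevCoeffs hw N).mul hcol).congr fun k _ m => ?_
  rw [evalHom, Finset.mul_sum, finsetSum_coeff]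
  refine Finset.sum_congr rfl fun j _ => ?_
  rw [mul_left_comm, coeff_C_mul, add_mul, coeff_add, coeff_C_mul, mul_assoc, coeff_C_mul]
  rcases m with _ | m
  · simp
  · rw [coeff_X_mul]
    simp

theorem nonneg_det_choose_sub_choose {w a b : ℤ} {e : ℕ} (hw : 0 ≤ w) (ha : 0 ≤ a) (hb : 0 ≤ b)
    (hS : X * (C a + C b * X) = (1 + X) ^ (1 + e) - (1 : ℤ[X]))
    (hL : C w * (C a + C b * X) = (1 + X) ^ e + (1 : ℤ[X])) (h : ℕ) {k : ℕ} {r c : Fin k → ℕ}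
    (hr : StrictMono r) (hc : StrictMono c) (hrh : ∀ s, r s ≤ h)
    (hcn : ∀ t, c t < 2 * h + 1 + e) :
    0 ≤ (Matrix.of fun s t => ((2 * h + 1 + e - r s).choose (2 * h + 1 + e - c t) : ℤ) -
      ((r s).choose (2 * h + 1 + e - c t) : ℤ)).det := by
  have key := nonnegMinors_coeff_mul_evalHom hw ha hb (h + 1) h k
    (fun s => h - r s.rev) (fun t => 2 * h + e - c t.rev)
    (fun s t hst => by
      have := hr (Fin.rev_lt_rev.2 hst); have := hrh s.rev; have := hrh t.rev; dsimp only; omega)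
    (fun s t hst => by
      have := hc (Fin.rev_lt_rev.2 hst); have := hcn s.rev; have := hcn t.rev; dsimp only; omega)
    (fun s => by omega)
  rw [← Matrix.det_submatrix_equiv_self Fin.revPerm]
  convert key using 2
  ext s t
  have hk := (mul_evalHom_chebyshevCoeffs hS hL (h - r s.rev) h (Nat.sub_le _ _)).1
  have hm : 2 * h + 1 + e - c t.rev = 2 * h + e - c t.rev + 1 := by have := hcn t.rev; omega
  have hrs := hrh s.rev
  rw [Nat.sub_sub_self hrs,
    show h + 1 + (h - r s.rev) + e = 2 * h + 1 + e - r s.rev by omega] at hk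
  have hcoeff := congrArg (fun p : ℤ[X] => p.coeff (2 * h + e - c t.rev + 1)) hk
  simp only [mul_assoc, coeff_X_mul, coeff_sub, coeff_one_add_X_pow] at hcoeff
  simp only [Matrix.submatrix_apply, Matrix.of_apply, Fin.revPerm_apply, hm]
  exact hcoeff.symm

/-- For every `n ≥ 2`, the matrix `W_n` with entries
`W(n,i,j) = C(n-i, n-j) - C(i, n-j)` if `i ≤ j` and `0` otherwise
(rows `0 ≤ i ≤ ⌈n/2⌉-1`, columns `0 ≤ j ≤ n-1`) is totally nonnegative. -/
theorem W_n_totally_nonnegative (n : ℕ) (hn : 2 ≤ n)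
    (W : Matrix (Fin ((n + 1) / 2)) (Fin n) ℤ)
    (hW : ∀ i j, W i j =
      if (i : ℕ) ≤ (j : ℕ) then
        ((n - (i : ℕ)).choose (n - (j : ℕ)) : ℤ) - ((i : ℕ).choose (n - (j : ℕ)) : ℤ)
      else 0) :
    ∀ (k : ℕ), 1 ≤ k → ∀ (r : Fin k → Fin ((n + 1) / 2)) (c : Fin k → Fin n),
      StrictMono r → StrictMono c → 0 ≤ (W.submatrix r c).det := by
  intro k _ r c hr hc
  have hentry : W.submatrix r c = Matrix.of fun s t =>
      ((n - (r s : ℕ)).choose (n - (c t : ℕ)) : ℤ) - ((r s : ℕ).choose (n - (c t : ℕ)) : ℤ) := by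
    ext s t
    rw [Matrix.submatrix_apply, hW, Matrix.of_apply]
    split_ifs with h
    · rfl
    · have := (r s).2
      rw [Nat.choose_eq_zero_of_lt (by omega), Nat.choose_eq_zero_of_lt (by omega)]
      simp
  have hr' : StrictMono fun s => (r s : ℕ) := fun _ _ h => hr h
  have hc' : StrictMono fun t => (c t : ℕ) := fun _ _ h => hc h
  have hrn (s) : (r s : ℕ) < (n + 1) / 2 := (r s).2
  have hcn (t) : (c t : ℕ) < n := (c t).2
  rw [hentry]
  rcases Nat.even_or_odd' n with ⟨m, hm | hm⟩
  · have hn' : n = 2 * (m - 1) + 1 + 1 := by omega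
    have := nonneg_det_choose_sub_choose (w := 1) (a := 2) (b := 1) (e := 1) (by simp) (by simp)
      (by simp) (by simp only [map_one, map_ofNat]; ring) (by simp only [map_one, map_ofNat]; ring)
      (m - 1) hr' hc' (fun s => by have := hrn s; omega) fun t => hn' ▸ hcn t
    rwa [← hn'] at this
  · have := nonneg_det_choose_sub_choose (w := 2) (a := 1) (b := 0) (e := 0) (by simp) (by simp)
      (by simp) (by simp) (by simp only [map_one, map_ofNat, map_zero]; ring)
      m hr' hc' (fun s => by have := hrn s; omega) fun t => hm ▸ hcn t
    rwa [Nat.add_zero, ← hm] at this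
end

section
/- For every integer d ≥ 1 and all indices 0 ≤ i_1 < i_2 ≤ ⌊d/2⌋ and 0 ≤ j_1 < j_2 ≤ d−1, the 2 × 2 minor m_{i_1 j_1} · m_{i_2 j_2} − m_{i_1 j_2} · m_{i_2 j_1} of the matrix M_d is nonnegative. -/
/-- `(k + 1) * C(n, k + 1) = (n - k) * C(n, k)` over the integers, without side conditions. -/
theorem succ_mul_choose_succ_int (n k : ℕ) :
    ((k : ℤ) + 1) * (n.choose (k + 1) : ℤ) = ((n : ℤ) - k) * (n.choose k : ℤ) := by
  rcases le_or_gt k n with h | h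
  · have := Nat.choose_succ_right_eq n k
    zify [h] at this
    linarith
  · simp [Nat.choose_eq_zero_of_lt h, Nat.choose_eq_zero_of_lt (Nat.lt_succ_of_lt h)]

/-- The ratio of `C(a, k + 1) + C(c, k + 1)` to `C(a, k) + C(c, k)` decreases when the pair
`(a, c)` is replaced by a nested pair with the same sum. -/
theorem choose_pair_minor_nonneg (k : ℕ) {a a' c' c : ℕ} (haa : a ≤ a') (hac : a' ≤ c')
    (hs : a + c = a' + c') :
    ((a.choose k : ℤ) + c.choose k) * ((a'.choose (k + 1) : ℤ) + c'.choose (k + 1)) ≤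
      ((a.choose (k + 1) : ℤ) + c.choose (k + 1)) * ((a'.choose k : ℤ) + c'.choose k) := by
  have ha := succ_mul_choose_succ_int a k
  have hc := succ_mul_choose_succ_int c k
  have ha' := succ_mul_choose_succ_int a' k
  have hc' := succ_mul_choose_succ_int c' k
  have mono_a : (a.choose k : ℤ) ≤ a'.choose k := mod_cast Nat.choose_le_choose k haa
  have mono_m : (a'.choose k : ℤ) ≤ c'.choose k := mod_cast Nat.choose_le_choose k hac
  have mono_c : (c'.choose k : ℤ) ≤ c.choose k :=
    mod_cast Nat.choose_le_choose k (by omega : c' ≤ c)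
  have nonneg_a : (0 : ℤ) ≤ a.choose k := by positivity
  generalize (a.choose k : ℤ) = A at *
  generalize (c.choose k : ℤ) = C at *
  generalize (a'.choose k : ℤ) = A' at *
  generalize (c'.choose k : ℤ) = C' at *
  generalize (a.choose (k + 1) : ℤ) = U at *
  generalize (c.choose (k + 1) : ℤ) = V at *
  generalize (a'.choose (k + 1) : ℤ) = U' at *
  generalize (c'.choose (k + 1) : ℤ) = V' at *
  have hpos : (0 : ℤ) < 2 * ((k : ℤ) + 1) := by positivity
  have hs' : (c : ℤ) = a' + c' - a := by
    have : (a : ℤ) + c = a' + c' := mod_cast hs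
    linarith
  have hda : (0 : ℤ) ≤ (a' : ℤ) - a := by
    have : (a : ℤ) ≤ a' := mod_cast haa
    linarith
  have hdc : (0 : ℤ) ≤ (c' : ℤ) - a' := by
    have : (a' : ℤ) ≤ c' := mod_cast hac
    linarith
  have cross : 0 ≤ C * A' - A * C' := by nlinarith
  have outer : 0 ≤ (C - A) * (C' + A') := mul_nonneg (by linarith) (by linarith)
  have key : 2 * ((k : ℤ) + 1) * ((U + V) * (A' + C') - (A + C) * (U' + V')) =
      2 * ((a' : ℤ) - a) * ((C - A) * (C' + A')) + 2 * ((c' : ℤ) - a') * (C * A' - A * C') := by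
    rw [hs'] at hc
    linear_combination 2 * (A' + C') * (ha + hc) - 2 * (A + C) * (ha' + hc')
  have : 0 ≤ (U + V) * (A' + C') - (A + C) * (U' + V') := by
    refine nonneg_of_mul_nonneg_right ?_ hpos
    rw [key]
    positivity
  linarith

/-- Enlarging the interval `[a + 1, b]` by one on both sides adds an outer pair to the difference
of binomial coefficients. -/
theorem choose_sub_choose_eq_pair_add (a b k : ℕ) :
    ((b + 1).choose (k + 1) : ℤ) - a.choose (k + 1) =
      ((a.choose k : ℤ) + b.choose k) + ((b.choose (k + 1) : ℤ) - (a + 1).choose (k + 1)) := by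
  rw [Nat.choose_succ_succ b k, Nat.choose_succ_succ a k]
  push_cast
  ring

/-- An outer pair has larger column ratio than any concentric interval difference. -/
theorem choose_pair_interval_minor_nonneg (k : ℕ) {a' c' : ℕ} : ∀ (t a : ℕ), a' ≤ a →
    a' + c' + 1 = a + (a + t) →
    ((a'.choose k : ℤ) + c'.choose k) * (((a + t).choose (k + 2) : ℤ) - a.choose (k + 2)) ≤
      ((a'.choose (k + 1) : ℤ) + c'.choose (k + 1)) *
        (((a + t).choose (k + 1) : ℤ) - a.choose (k + 1))
  | 0, a, _, _ => by simp
  | 1, a, h, hs => by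
    have := choose_pair_minor_nonneg k h le_rfl (show a' + c' = a + a by omega)
    rw [Nat.choose_succ_succ a k, Nat.choose_succ_succ a (k + 1)]
    push_cast
    linarith
  | t + 2, a, h, hs => by
    have ih := choose_pair_interval_minor_nonneg k (a' := a') (c' := c') t (a + 1)
      (by omega) (by omega)
    have hp := choose_pair_minor_nonneg k h (show a ≤ a + 1 + t by omega)
      (show a' + c' = a + (a + 1 + t) by omega)
    rw [show a + (t + 2) = a + 1 + t + 1 by ring, choose_sub_choose_eq_pair_add,
      choose_sub_choose_eq_pair_add]
    linarith

/-- Minors on two adjacent columns, for concentric intervals. -/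
theorem choose_interval_minor_nonneg (k t : ℕ) : ∀ (u a : ℕ),
    (((a + 2 * u + t).choose (k + 1) : ℤ) - a.choose (k + 1)) *
        (((a + u + t).choose (k + 2) : ℤ) - (a + u).choose (k + 2)) ≤
      (((a + 2 * u + t).choose (k + 2) : ℤ) - a.choose (k + 2)) *
        (((a + u + t).choose (k + 1) : ℤ) - (a + u).choose (k + 1))
  | 0, a => by simp [mul_comm]
  | u + 1, a => by
    have ih := choose_interval_minor_nonneg k t u (a + 1)
    have hp := choose_pair_interval_minor_nonneg k (a' := a) (c' := a + 1 + 2 * u + t) t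
      (a + 1 + u) (by omega) (by omega)
    rw [show a + 2 * (u + 1) + t = a + 1 + 2 * u + t + 1 by ring,
      show a + (u + 1) = a + 1 + u by ring, choose_sub_choose_eq_pair_add,
      choose_sub_choose_eq_pair_add]
    linarith

/-- For nonnegative sequences such that `G` stays zero once it vanishes, nonnegativity of the
minors on adjacent columns implies nonnegativity of all minors. -/
theorem minor_nonneg_of_adjacent {F G : ℕ → ℤ} (hF : ∀ k, 0 ≤ F k) (hG : ∀ k, 0 ≤ G k)
    (hzero : ∀ k, G k = 0 → G (k + 1) = 0)
    (hadj : ∀ k, F k * G (k + 1) ≤ F (k + 1) * G k) {k l : ℕ} (hkl : k ≤ l) :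
    F k * G l ≤ F l * G k := by
  induction l, hkl using Nat.le_induction with
  | base => exact le_rfl
  | succ l _ ih =>
    rcases (hG l).eq_or_lt with h | h
    · rw [hzero l h.symm, mul_zero]
      exact mul_nonneg (hF _) (hG _)
    · refine le_of_mul_le_mul_right ?_ h
      have h₁ := mul_le_mul_of_nonneg_right ih (hG (l + 1))
      have h₂ := mul_le_mul_of_nonneg_right (hadj l) (hG k)
      linarith

/-- Once `C(b, k + 1) - C(a, k + 1)` with `a < b` vanishes, so does the next difference. -/
theorem choose_sub_choose_succ_eq_zero {a b k : ℕ} (hab : a < b)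
    (h : (b.choose (k + 1) : ℤ) - a.choose (k + 1) = 0) :
    (b.choose (k + 2) : ℤ) - a.choose (k + 2) = 0 := by
  have hb : b < k + 1 := by
    by_contra! hk
    obtain ⟨n, rfl⟩ : ∃ n, b = n + 1 := ⟨b - 1, by omega⟩
    have hmono : a.choose (k + 1) ≤ n.choose (k + 1) := Nat.choose_le_choose _ (by omega)
    have hpos : 0 < n.choose k := Nat.choose_pos (by omega)
    rw [Nat.choose_succ_succ n k] at h
    simp only [Nat.succ_eq_add_one] at h
    omega
  rw [Nat.choose_eq_zero_of_lt (by omega : b < k + 2),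
    Nat.choose_eq_zero_of_lt (by omega : a < k + 2), sub_self]

/-- Björner's theorem: every `2 × 2` minor of `M_d` is nonnegative. Here
`m i j = C(d+1-i, d-j) - C(i, d-j)`. -/
theorem M_d_two_by_two_minors_nonneg (d i₁ i₂ j₁ j₂ : ℕ) (hd : 1 ≤ d)
    (hi : i₁ < i₂) (hi₂ : i₂ ≤ d / 2) (hj : j₁ < j₂) (hj₂ : j₂ ≤ d - 1)
    (m : ℕ → ℕ → ℤ)
    (hm : ∀ i j, m i j = ((d + 1 - i).choose (d - j) : ℤ) - (i.choose (d - j) : ℤ)) :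
    0 ≤ m i₁ j₁ * m i₂ j₂ - m i₁ j₂ * m i₂ j₁ := by
  have nonneg : ∀ i ≤ i₂, ∀ k : ℕ,
      0 ≤ ((d + 1 - i).choose (k + 1) : ℤ) - i.choose (k + 1) := fun i h k =>
    sub_nonneg.2 (mod_cast Nat.choose_le_choose _ (by omega))
  have key := minor_nonneg_of_adjacent
    (F := fun k => ((d + 1 - i₁).choose (k + 1) : ℤ) - i₁.choose (k + 1))
    (G := fun k => ((d + 1 - i₂).choose (k + 1) : ℤ) - i₂.choose (k + 1))
    (nonneg i₁ hi.le) (nonneg i₂ le_rfl)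
    (fun k => choose_sub_choose_succ_eq_zero (by omega))
    (fun k => by
      have := choose_interval_minor_nonneg k (d + 1 - 2 * i₂) (i₂ - i₁) i₁
      rwa [show i₁ + 2 * (i₂ - i₁) + (d + 1 - 2 * i₂) = d + 1 - i₁ by omega,
        show i₁ + (i₂ - i₁) + (d + 1 - 2 * i₂) = d + 1 - i₂ by omega,
        show i₁ + (i₂ - i₁) = i₂ by omega] at this)
    (show d - j₂ - 1 ≤ d - j₁ - 1 by omega)
  simp only [show d - j₂ - 1 + 1 = d - j₂ by omega, show d - j₁ - 1 + 1 = d - j₁ by omega] at key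
  simp only [hm]
  linarith
end

section
/- Let n ≥ 2 be an integer, set a = ⌈n/2⌉ − 1, and let i, j be integers with 0 ≤ i ≤ a and 0 ≤ j ≤ n−1. Then the number of monotone lattice paths in ℤ² from (a−i, i) to (a, j), using only steps (1,0) and (0,1), all of whose points (x,y) satisfy y − x ≤ ⌊n/2⌋, equals binomial(j,i) − binomial(j, n−i) when i ≤ j, and equals 0 when i > j. -/
/-- `L` is a monotone lattice path in `ℤ²` from `p` to `q`: a finite sequence of points
starting at `p`, ending at `q`, in which each consecutive step is `(1,0)` or `(0,1)`. -/
def IsLatticePath (p q : ℤ × ℤ) (L : List (ℤ × ℤ)) : Prop :=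
  L.head? = some p ∧ L.getLast? = some q ∧
    List.Chain' (fun u v => v = u + (1, 0) ∨ v = u + (0, 1)) L

/-- The binomial coefficient `C(k, z)` with an integer lower index, zero when `z < 0`. -/
def intChoose (k : ℕ) (z : ℤ) : ℤ := if 0 ≤ z then (k.choose z.toNat : ℤ) else 0

theorem intChoose_natCast (k z : ℕ) : intChoose k z = k.choose z := by
  simp [intChoose]

theorem intChoose_of_neg {k : ℕ} {z : ℤ} (h : z < 0) : intChoose k z = 0 :=
  if_neg (not_le.mpr h)

theorem intChoose_zero_left (z : ℤ) : intChoose 0 z = if z = 0 then 1 else 0 := by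
  rcases lt_or_ge z 0 with h | h
  · rw [intChoose_of_neg h, if_neg h.ne]
  · lift z to ℕ using h
    rw [intChoose_natCast]
    cases z <;> simp
    omega

theorem intChoose_succ (k : ℕ) (z : ℤ) :
    intChoose (k + 1) z = intChoose k z + intChoose k (z - 1) := by
  rcases lt_or_ge z 0 with h | h
  · rw [intChoose_of_neg h, intChoose_of_neg h, intChoose_of_neg (by omega), add_zero]
  · lift z to ℕ using h
    cases z with
    | zero => simp [intChoose]
    | succ z =>
      rw [show ((z + 1 : ℕ) : ℤ) - 1 = (z : ℕ) by push_cast; ring]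
      simp only [intChoose_natCast, Nat.choose_succ_succ]
      push_cast
      ring

theorem intChoose_symm {k : ℕ} {z w : ℤ} (h : z + w = k) : intChoose k z = intChoose k w := by
  rcases lt_or_ge z 0 with hz | hz
  · lift w to ℕ using by omega
    rw [intChoose_of_neg hz, intChoose_natCast, Nat.choose_eq_zero_of_lt (by omega), Nat.cast_zero]
  · lift z to ℕ using hz
    rcases lt_or_ge w 0 with hw | hw
    · rw [intChoose_of_neg hw, intChoose_natCast, Nat.choose_eq_zero_of_lt (by omega),
        Nat.cast_zero]
    · lift w to ℕ using hw
      rw [intChoose_natCast, intChoose_natCast,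
        Nat.choose_symm_of_eq_add (show k = z + w by omega)]

theorem isLatticePath_iff (p q : ℤ × ℤ) (L : List (ℤ × ℤ)) :
    IsLatticePath p q L ↔ L.head? = some p ∧ L.getLast? = some q ∧
      L.IsChain (fun u v => v = u + (1, 0) ∨ v = u + (0, 1)) :=
  Iff.rfl

theorem isLatticePath_nil (p q : ℤ × ℤ) : ¬ IsLatticePath p q [] := by
  simp [isLatticePath_iff]

theorem isLatticePath_singleton (p q u : ℤ × ℤ) :
    IsLatticePath p q [u] ↔ u = p ∧ u = q := by
  simp [isLatticePath_iff]

theorem isLatticePath_cons_cons (p q u v : ℤ × ℤ) (L : List (ℤ × ℤ)) :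
    IsLatticePath p q (u :: v :: L) ↔
      u = p ∧ (IsLatticePath (p + (1, 0)) q (v :: L) ∨ IsLatticePath (p + (0, 1)) q (v :: L)) := by
  simp only [isLatticePath_iff, List.head?_cons, Option.some.injEq, List.getLast?_cons_cons,
    List.isChain_cons_cons]
  constructor
  · rintro ⟨rfl, h, h' | h', h''⟩ <;> simp_all
  · rintro ⟨rfl, ⟨h, h', h''⟩ | ⟨h, h', h''⟩⟩ <;> simp_all

theorem IsLatticePath.sum_le {p q : ℤ × ℤ} {L : List (ℤ × ℤ)} (h : IsLatticePath p q L) :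
    p.1 + p.2 ≤ q.1 + q.2 := by
  induction L generalizing p with
  | nil => exact absurd h (isLatticePath_nil p q)
  | cons u L ih =>
    cases L with
    | nil =>
      obtain ⟨rfl, rfl⟩ := (isLatticePath_singleton p q u).mp h
      exact le_rfl
    | cons v L =>
      obtain ⟨-, h | h⟩ := (isLatticePath_cons_cons p q u v L).mp h <;>
      · have := ih h
        simp only [Prod.fst_add, Prod.snd_add] at this
        omega

/-- The lattice paths from `p` to `q` all of whose points `(x, y)` satisfy `y - x ≤ m`. -/
def boundedPaths (m : ℤ) (q p : ℤ × ℤ) : Set (List (ℤ × ℤ)) :=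
  {L | IsLatticePath p q L ∧ ∀ r ∈ L, r.2 - r.1 ≤ m}

theorem boundedPaths_eq_empty {m : ℤ} {q p : ℤ × ℤ} (h : m < p.2 - p.1) :
    boundedPaths m q p = ∅ := by
  ext L
  simp only [boundedPaths, Set.mem_ofPred_eq, Set.mem_empty_iff_false, iff_false, not_and]
  intro hL hb
  have := hb p (List.mem_of_mem_head? hL.1)
  omega

theorem boundedPaths_self {m : ℤ} {p : ℤ × ℤ} (h : p.2 - p.1 ≤ m) :
    boundedPaths m p p = {[p]} := by
  ext L
  simp only [boundedPaths, Set.mem_ofPred_eq, Set.mem_singleton_iff]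
  constructor
  · rintro ⟨hL, -⟩
    rcases L with _ | ⟨u, _ | ⟨v, L⟩⟩
    · exact absurd hL (isLatticePath_nil p p)
    · rw [((isLatticePath_singleton p p u).mp hL).1]
    · obtain ⟨-, h | h⟩ := (isLatticePath_cons_cons p p u v L).mp hL <;>
      · have := h.sum_le
        simp only [Prod.fst_add, Prod.snd_add] at this
        omega
  · rintro rfl
    exact ⟨(isLatticePath_singleton p p p).mpr ⟨rfl, rfl⟩, by simpa using h⟩

theorem boundedPaths_step {m : ℤ} {q p : ℤ × ℤ} (h : p.2 - p.1 ≤ m) (hpq : p ≠ q) :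
    boundedPaths m q p =
      List.cons p '' (boundedPaths m q (p + (1, 0)) ∪ boundedPaths m q (p + (0, 1))) := by
  ext L
  simp only [boundedPaths, Set.mem_ofPred_eq, Set.mem_image, Set.mem_union]
  constructor
  · rintro ⟨hL, hb⟩
    rcases L with _ | ⟨u, _ | ⟨v, L⟩⟩
    · exact absurd hL (isLatticePath_nil p q)
    · obtain ⟨rfl, rfl⟩ := (isLatticePath_singleton p q u).mp hL
      exact absurd rfl hpq
    · obtain ⟨rfl, hs⟩ := (isLatticePath_cons_cons p q u v L).mp hL
      have hb' := fun r hr => hb r (List.mem_cons_of_mem u hr)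
      exact ⟨v :: L, hs.imp (⟨·, hb'⟩) (⟨·, hb'⟩), rfl⟩
  · rintro ⟨L, hL, rfl⟩
    rw [← or_and_right] at hL
    refine ⟨?_, List.forall_mem_cons.mpr ⟨h, hL.2⟩⟩
    rcases L with _ | ⟨v, L⟩
    · simp [isLatticePath_nil] at hL
    · exact (isLatticePath_cons_cons p q p v L).mpr ⟨rfl, hL.1⟩

theorem disjoint_boundedPaths {m : ℤ} {q p p' : ℤ × ℤ} (h : p ≠ p') :
    Disjoint (boundedPaths m q p) (boundedPaths m q p') := by
  rw [Set.disjoint_left]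
  rintro L ⟨hL, -⟩ ⟨hL', -⟩
  exact h (Option.some.inj (hL.1.symm.trans hL'.1))

/-- The reflection principle: the subtracted term counts the unrestricted paths from `p` to the
reflection `(q.2 - m - 1, q.1 + m + 1)` of `q` in the line `y - x = m + 1`. -/
theorem finite_and_ncard_boundedPaths {m : ℤ} {q : ℤ × ℤ} (hq : q.2 - q.1 ≤ m) (k : ℕ)
    (p : ℤ × ℤ) (hk : p.1 + p.2 + k = q.1 + q.2) (hp : p.2 - p.1 ≤ m + 1) :
    (boundedPaths m q p).Finite ∧ ((boundedPaths m q p).ncard : ℤ) =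
      intChoose k (q.2 - p.2) - intChoose k (q.1 + m + 1 - p.2) := by
  induction k generalizing p with
  | zero =>
    rw [intChoose_zero_left, intChoose_zero_left]
    rw [Nat.cast_zero, add_zero] at hk
    rw [if_neg (show q.1 + m + 1 - p.2 ≠ 0 by omega), sub_zero]
    by_cases hpq : p = q
    · subst hpq
      rw [boundedPaths_self hq]
      simp
    · have hne : q.2 - p.2 ≠ 0 := fun h => hpq (Prod.ext (by omega) (by omega))
      have hempty : boundedPaths m q p = ∅ := by
        by_cases hp' : p.2 - p.1 ≤ m
        · rw [boundedPaths_step hp' hpq, Set.image_eq_empty, Set.eq_empty_iff_forall_notMem]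
          rintro L (⟨hL, -⟩ | ⟨hL, -⟩) <;>
          · have := hL.sum_le
            simp only [Prod.fst_add, Prod.snd_add] at this
            omega
        · exact boundedPaths_eq_empty (not_le.mp hp')
      simp [hempty, hne]
  | succ k ih =>
    push_cast at hk
    by_cases hp' : p.2 - p.1 ≤ m
    · have hpq : p ≠ q := by
        rintro rfl
        omega
      obtain ⟨hfr, hr⟩ := ih (p + (1, 0)) (by simp only [Prod.fst_add, Prod.snd_add]; omega)
        (by simp only [Prod.fst_add, Prod.snd_add]; omega)
      obtain ⟨hfu, hu⟩ := ih (p + (0, 1)) (by simp only [Prod.fst_add, Prod.snd_add]; omega)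
        (by simp only [Prod.fst_add, Prod.snd_add]; omega)
      have hne : p + (1, 0) ≠ p + (0, 1) := by simp
      rw [boundedPaths_step hp' hpq]
      refine ⟨(hfr.union hfu).image _, ?_⟩
      rw [Set.ncard_image_of_injective _ List.cons_injective,
        Set.ncard_union_eq (disjoint_boundedPaths hne) hfr hfu, Nat.cast_add, hr, hu,
        intChoose_succ, intChoose_succ]
      simp only [Prod.snd_add, add_zero, ← sub_sub]
      ring
    · rw [boundedPaths_eq_empty (not_le.mp hp'), intChoose_symm (w := q.1 + m + 1 - p.2)
        (by push_cast; omega)]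
      simp

/-- For `n ≥ 2`, `a = ⌈n/2⌉ - 1`, `0 ≤ i ≤ a` and `0 ≤ j ≤ n-1`, the number of
monotone lattice paths from `(a-i, i)` to `(a, j)` all of whose points `(x,y)` satisfy
`y - x ≤ ⌊n/2⌋` equals `C(j,i) - C(j, n-i)` when `i ≤ j`, and `0` when `i > j`. -/
theorem lattice_path_count_T_n (n : ℕ) (hn : 2 ≤ n) (a : ℕ) (ha : a = (n + 1) / 2 - 1)
    (i j : ℕ) (hi : i ≤ a) (hj : j ≤ n - 1) :
    (Nat.card {L : List (ℤ × ℤ) //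
        IsLatticePath ((a : ℤ) - (i : ℤ), (i : ℤ)) ((a : ℤ), (j : ℤ)) L ∧
        ∀ p ∈ L, p.2 - p.1 ≤ (n / 2 : ℕ)} : ℤ) =
      if i ≤ j then (j.choose i : ℤ) - (j.choose (n - i) : ℤ) else 0 := by
  have hcount := (finite_and_ncard_boundedPaths (m := (n / 2 : ℕ)) (q := ((a : ℤ), (j : ℤ)))
    (by dsimp only; omega) j ((a : ℤ) - (i : ℤ), (i : ℤ)) (by dsimp only; omega)
    (by dsimp only; omega)).2
  refine hcount.trans ?_
  dsimp only
  rw [show (a : ℤ) + (n / 2 : ℕ) + 1 - i = (n - i : ℕ) by omega, intChoose_natCast,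
    intChoose_symm (w := i) (by omega), intChoose_natCast]
  split_ifs with hij
  · rfl
  · rw [Nat.choose_eq_zero_of_lt (by omega : j < i),
      Nat.choose_eq_zero_of_lt (by omega : j < n - i), sub_self]
end
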